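/- arXiv:1608.07652 — 7 statements merged into one kernel-verified Lean document; each statement's English description precedes it below -/
import Mathlib

section
/- Let d ≥ 3 and let S, T ⊆ {1,…,d} be such that there exists i ∈ S ∩ T with S \ {i} ≠ ∅ and T \ {i} ≠ ∅. Then the function h(x) = 2|x| + χ_S(x) + χ_T(x) is 1/8-far from unate: every unate function g : {0,1}^d → ℝ satisfies |{x ∈ {0,1}^d : g(x) ≠ h(x)}| ≥ 2^d / 8. -/
open Finset
open scoped Classical

/-- Hamming weight of a point of the hypercube `{0,1}^d`. -/
def hammingWt {d : ℕ} (x : Fin d → Bool) : ℕ :=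
  (univ.filter fun i => x i).card

/-- The character `χ_S(x) = (-1)^{Σ_{i∈S} x_i}`. -/
def chi {d : ℕ} (S : Finset (Fin d)) (x : Fin d → Bool) : ℤ :=
  (-1) ^ (S.filter fun i => x i).card

/-- The function `h(x) = 2|x| + χ_S(x) + χ_T(x)`. -/
def hFun {d : ℕ} (S T : Finset (Fin d)) (x : Fin d → Bool) : ℤ :=
  2 * (hammingWt x : ℤ) + chi S x + chi T x

/-- A function on the hypercube is unate if there is an orientation of the
coordinates making it monotone with respect to that orientation. -/
def IsUnate {d : ℕ} {R : Type*} [Preorder R] (f : (Fin d → Bool) → R) : Prop :=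
  ∃ σ : Fin d → Bool, ∀ (i : Fin d) (x : Fin d → Bool),
    if σ i then f (Function.update x i false) ≤ f (Function.update x i true)
    else f (Function.update x i true) ≤ f (Function.update x i false)

theorem chi_eq_prod_ite {d : ℕ} (S : Finset (Fin d)) (x : Fin d → Bool) :
    chi S x = ∏ j, if j ∈ S ∧ x j = true then (-1 : ℤ) else 1 := by
  rw [chi, Finset.prod_ite, Finset.prod_const, Finset.prod_const_one, mul_one]
  congr 2
  ext j
  simp

theorem chi_mul_chi {d : ℕ} (S T : Finset (Fin d)) (x : Fin d → Bool) :
    chi S x * chi T x = chi (symmDiff S T) x := by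
  simp only [chi_eq_prod_ite, ← Finset.prod_mul_distrib]
  refine Finset.prod_congr rfl fun j _ => ?_
  by_cases h₁ : j ∈ S <;> by_cases h₂ : j ∈ T <;> cases x j <;>
    simp [Finset.mem_symmDiff, h₁, h₂]

theorem chi_eq_one_or_neg_one {d : ℕ} (S : Finset (Fin d)) (x : Fin d → Bool) :
    chi S x = 1 ∨ chi S x = -1 :=
  neg_one_pow_eq_or ℤ _

theorem sum_chi {d : ℕ} (S : Finset (Fin d)) :
    ∑ x, chi S x = ∏ j, if j ∈ S then (0 : ℤ) else 2 := by
  simp only [chi_eq_prod_ite]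
  rw [← Fintype.prod_sum fun (j : Fin d) (b : Bool) =>
    if j ∈ S ∧ b = true then (-1 : ℤ) else 1]
  refine Finset.prod_congr rfl fun j _ => ?_
  by_cases h : j ∈ S <;> simp [h]

theorem sum_chi_nonneg {d : ℕ} (S : Finset (Fin d)) : 0 ≤ ∑ x, chi S x := by
  rw [sum_chi]
  exact Finset.prod_nonneg fun j _ => by split_ifs <;> norm_num

theorem sum_chi_eq_zero {d : ℕ} {S : Finset (Fin d)} (hS : S.Nonempty) :
    ∑ x, chi S x = 0 := by
  obtain ⟨j, hj⟩ := hS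
  rw [sum_chi]
  exact Finset.prod_eq_zero (Finset.mem_univ j) (by simp [hj])

theorem chi_singleton {d : ℕ} (i : Fin d) (x : Fin d → Bool) :
    chi {i} x = if x i = true then -1 else 1 := by
  by_cases h : x i = true <;> simp [chi, Finset.filter_singleton, h]

theorem chi_update_true {d : ℕ} {S : Finset (Fin d)} {i : Fin d} (hi : i ∈ S)
    {x : Fin d → Bool} (hx : x i = false) :
    chi S (Function.update x i true) = -chi S x := by
  simp only [chi_eq_prod_ite, ← Finset.mul_prod_erase univ _ (Finset.mem_univ i)]
  have : ∀ j ∈ univ.erase i, Function.update x i true j = x j := fun j hj =>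
    Function.update_of_ne (Finset.ne_of_mem_erase hj) _ _
  rw [Finset.prod_congr rfl fun j hj => by rw [this j hj]]
  simp [hi, hx]

theorem hammingWt_update_true {d : ℕ} {i : Fin d} {x : Fin d → Bool} (hx : x i = false) :
    hammingWt (Function.update x i true) = hammingWt x + 1 := by
  have h : (univ.filter fun j => Function.update x i true j = true)
      = insert i (univ.filter fun j => x j = true) := by
    ext j
    by_cases hj : j = i
    · subst hj; simp
    · simp [hj]
  rw [hammingWt, hammingWt]
  convert congrArg Finset.card h using 1
  rw [Finset.card_insert_of_notMem (by simp [hx])]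

theorem hFun_update_true {d : ℕ} {S T : Finset (Fin d)} {i : Fin d} (hiS : i ∈ S)
    (hiT : i ∈ T) {x : Fin d → Bool} (hx : x i = false) :
    hFun S T (Function.update x i true) = hFun S T x + 2 - 2 * chi S x - 2 * chi T x := by
  rw [hFun, hFun, hammingWt_update_true hx, chi_update_true hiS hx, chi_update_true hiT hx]
  push_cast
  ring

theorem two_pow_le_eight_mul_card_chi_eq_one {d : ℕ} (S T : Finset (Fin d)) (i : Fin d) :
    2 ^ d ≤ 8 * (univ.filter fun x : Fin d → Bool =>
      x i = false ∧ chi S x = 1 ∧ chi T x = 1).card := by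
  zify
  rw [Finset.card_filter]
  push_cast
  rw [Finset.mul_sum]
  have key : ∀ x : Fin d → Bool,
      (8 * if x i = false ∧ chi S x = 1 ∧ chi T x = 1 then (1 : ℤ) else 0)
        = 1 + chi {i} x + chi S x + chi T x + chi (symmDiff {i} S) x + chi (symmDiff {i} T) x
          + chi (symmDiff S T) x + chi (symmDiff (symmDiff {i} S) T) x := by
    intro x
    simp only [← chi_mul_chi, chi_singleton]
    rcases chi_eq_one_or_neg_one S x with h₁ | h₁ <;>
      rcases chi_eq_one_or_neg_one T x with h₂ | h₂ <;>
      cases x i <;> simp [h₁, h₂]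
  rw [Finset.sum_congr rfl fun x _ => key x]
  simp only [Finset.sum_add_distrib]
  have h : ∑ _x : Fin d → Bool, (1 : ℤ) = 2 ^ d := by simp
  have := sum_chi_nonneg ({i} : Finset (Fin d))
  have := sum_chi_nonneg S
  have := sum_chi_nonneg T
  have := sum_chi_nonneg (symmDiff {i} S)
  have := sum_chi_nonneg (symmDiff {i} T)
  have := sum_chi_nonneg (symmDiff S T)
  have := sum_chi_nonneg (symmDiff (symmDiff {i} S) T)
  linarith

theorem two_pow_le_four_mul_card_chi_eq_neg_one {d : ℕ} {S : Finset (Fin d)} {i : Fin d}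
    (hi : i ∈ S) (hS : (S.erase i).Nonempty) :
    2 ^ d ≤ 4 * (univ.filter fun x : Fin d → Bool => x i = false ∧ chi S x = -1).card := by
  zify
  rw [Finset.card_filter]
  push_cast
  rw [Finset.mul_sum]
  have key : ∀ x : Fin d → Bool, (4 * if x i = false ∧ chi S x = -1 then (1 : ℤ) else 0)
        = 1 + chi {i} x - chi S x - chi (symmDiff {i} S) x := by
    intro x
    simp only [← chi_mul_chi, chi_singleton]
    rcases chi_eq_one_or_neg_one S x with h | h <;> cases x i <;> simp [h]
  rw [Finset.sum_congr rfl fun x _ => key x]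
  simp only [Finset.sum_add_distrib, Finset.sum_sub_distrib]
  have h : ∑ _x : Fin d → Bool, (1 : ℤ) = 2 ^ d := by simp
  have := sum_chi_nonneg ({i} : Finset (Fin d))
  have := sum_chi_eq_zero ⟨i, hi⟩
  have hne : (symmDiff {i} S).Nonempty := by
    obtain ⟨j, hj⟩ := hS
    rw [Finset.mem_erase] at hj
    exact ⟨j, by simp [Finset.mem_symmDiff, hj.1, hj.2]⟩
  have := sum_chi_eq_zero hne
  linarith

theorem card_le_of_mem_or_update_mem {d : ℕ} {V B : Finset (Fin d → Bool)} {i : Fin d}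
    (hV : ∀ x ∈ V, x i = false) (hB : ∀ x ∈ V, x ∈ B ∨ Function.update x i true ∈ B) :
    V.card ≤ B.card := by
  refine Finset.card_le_card_of_injOn
    (fun x => if x ∈ B then x else Function.update x i true) (fun x hx => ?_) ?_
  · by_cases h : x ∈ B
    · simp [h]
    · simpa [h] using (hB x hx).resolve_left h
  · intro x hx y hy hxy
    have restore : ∀ z ∈ V,
        Function.update (if z ∈ B then z else Function.update z i true) i false = z := by
      intro z hz
      split_ifs <;> simp [← hV z hz]
    have := congrArg (fun z => Function.update z i false) hxy
    simpa only [restore x hx, restore y hy] using this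

theorem stmt_3 (d : ℕ) (hd : 3 ≤ d) (S T : Finset (Fin d)) (i : Fin d)
    (hiS : i ∈ S) (hiT : i ∈ T)
    (hS : (S.erase i).Nonempty) (hT : (T.erase i).Nonempty)
    (g : (Fin d → Bool) → ℝ) (hg : IsUnate g) :
    (2 : ℝ) ^ d / 8 ≤
      ((univ.filter fun x : Fin d → Bool => g x ≠ (hFun S T x : ℝ)).card : ℝ) := by
  obtain ⟨σ, hσ⟩ := hg
  have hmono := hσ i
  set B := univ.filter fun x : Fin d → Bool => g x ≠ (hFun S T x : ℝ) with hBdef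
  have hmem : ∀ x, x ∉ B → g x = hFun S T x := fun x hx => by
    by_contra h
    exact hx (by simp [hBdef, h])
  suffices h : 2 ^ d ≤ 8 * B.card by
    have : (2 : ℝ) ^ d ≤ 8 * B.card := by exact_mod_cast h
    linarith
  by_cases hup : σ i = true
  · simp only [hup, if_true] at hmono
    refine (two_pow_le_eight_mul_card_chi_eq_one S T i).trans (Nat.mul_le_mul_left 8 ?_)
    refine card_le_of_mem_or_update_mem (i := i) (fun x hx => (Finset.mem_filter.1 hx).2.1)
      fun x hx => ?_
    obtain ⟨-, hx, hs, ht⟩ := Finset.mem_filter.1 hx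
    by_contra! hcon
    have hle := hmono x
    rw [← hx, Function.update_eq_self, hmem _ hcon.1, hmem _ hcon.2] at hle
    have hle' : hFun S T x ≤ hFun S T (Function.update x i true) := by exact_mod_cast hle
    rw [hFun_update_true hiS hiT hx] at hle'
    omega
  · rw [Bool.not_eq_true] at hup
    simp only [hup, Bool.false_eq_true, if_false] at hmono
    have hcount := two_pow_le_four_mul_card_chi_eq_neg_one hiS hS
    suffices h : (univ.filter fun x : Fin d → Bool => x i = false ∧ chi S x = -1).card
        ≤ B.card by omega
    refine card_le_of_mem_or_update_mem (i := i) (fun x hx => (Finset.mem_filter.1 hx).2.1)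
      fun x hx => ?_
    obtain ⟨-, hx, hs⟩ := Finset.mem_filter.1 hx
    by_contra! hcon
    have hle := hmono x
    rw [← hx, Function.update_eq_self, hmem _ hcon.1, hmem _ hcon.2] at hle
    have hle' : hFun S T (Function.update x i true) ≤ hFun S T x := by exact_mod_cast hle
    rw [hFun_update_true hiS hiT hx] at hle'
    rcases chi_eq_one_or_neg_one T x with ht | ht <;> omega
end

section
/- Let m ≤ d, let ε ∈ (0,1), let g : {0,1}^m → ℝ, and define the padded function h : {0,1}^d → ℝ by h(x, y) = g(x) for x ∈ {0,1}^m and y ∈ {0,1}^{d−m}. If g is ε-far from unate (every unate function on {0,1}^m differs from g on at least ε·2^m points), then h is ε-far from unate (every unate function on {0,1}^d differs from h on at least ε·2^d points). -/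
open Finset

open scoped Classical

theorem Fin.append_update_castAdd {m k : ℕ} {α : Type*} (x : Fin m → α) (y : Fin k → α)
    (i : Fin m) (b : α) :
    Fin.append (Function.update x i b) y =
      Function.update (Fin.append x y) (Fin.castAdd k i) b := by
  ext j
  refine Fin.addCases (fun j => ?_) (fun j => ?_) j
  · simp [Function.update_apply]
  · rw [Fin.append_right, Function.update_of_ne, Fin.append_right]
    intro hj
    have := congrArg Fin.val hj
    simp at this
    omega

/-- Fixing the last coordinates of a unate function gives a unate function. -/
theorem IsUnate.append_right {m k : ℕ} {R : Type*} [Preorder R] {f : (Fin (m + k) → Bool) → R}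
    (hf : IsUnate f) (y : Fin k → Bool) : IsUnate fun x : Fin m → Bool => f (Fin.append x y) := by
  obtain ⟨σ, hσ⟩ := hf
  refine ⟨fun i => σ (Fin.castAdd k i), fun i x => ?_⟩
  simpa only [Fin.append_update_castAdd] using hσ (Fin.castAdd k i) (Fin.append x y)

theorem card_filter_eq_sum_card_filter_append {m k : ℕ} (p : (Fin (m + k) → Bool) → Prop)
    [DecidablePred p] :
    (univ.filter p).card =
      ∑ y : Fin k → Bool, (univ.filter fun x : Fin m → Bool => p (Fin.append x y)).card := by
  simp only [Finset.card_filter]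
  rw [← (Fin.appendEquiv m k).sum_comp, Fintype.sum_prod_type_right]
  rfl

theorem stmt_8 (m d : ℕ) (hmd : m ≤ d) (ε : ℝ) (hε0 : 0 < ε) (hε1 : ε < 1)
    (g : (Fin m → Bool) → ℝ) (h : (Fin d → Bool) → ℝ)
    (hpad : ∀ x : Fin d → Bool, h x = g (fun j => x (Fin.castLE hmd j)))
    (hgfar : ∀ g' : (Fin m → Bool) → ℝ, IsUnate g' →
      ε * 2 ^ m ≤ ((univ.filter fun x : Fin m → Bool => g' x ≠ g x).card : ℝ)) :
    ∀ h' : (Fin d → Bool) → ℝ, IsUnate h' →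
      ε * 2 ^ d ≤ ((univ.filter fun x : Fin d → Bool => h' x ≠ h x).card : ℝ) := by
  intro h' hh'
  obtain ⟨k, rfl⟩ := Nat.exists_eq_add_of_le hmd
  have h_append (x : Fin m → Bool) (y : Fin k → Bool) : h (Fin.append x y) = g x := by
    rw [hpad]
    exact congrArg g (funext (Fin.append_left x y))
  rw [card_filter_eq_sum_card_filter_append]
  simp only [h_append]
  push_cast
  calc ε * 2 ^ (m + k) = ∑ _y : Fin k → Bool, ε * 2 ^ m := by
        simp [pow_add]
        ring
    _ ≤ _ := Finset.sum_le_sum fun y _ => hgfar _ (hh'.append_right y)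
end

section
/- There exist a constant ε with 0 < ε ≤ 1/4 and a threshold d₀ such that for every even d ≥ d₀ and every i ∈ {1,…,d/2}, the function f_i is ε-far from unate: every unate function g : {0,1}^d → {0,1} satisfies |{x ∈ {0,1}^d : g(x) ≠ f_i(x)}| ≥ ε·2^d. -/
open Finset
open scoped Classical

/-- The "hard" function `f_i` on the hypercube `{0,1}^d` with `d = e + e` even:
its value is `1` above the middle band, `0` below it, and `x_i ⊕ x_{i+d/2}`
inside the band `d/2 - √d ≤ |x| ≤ d/2 + √d`. -/
noncomputable def fHard {e : ℕ} (i : Fin e) (x : Fin (e + e) → Bool) : Bool :=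
  if (hammingWt x : ℝ) > ((e + e : ℕ) : ℝ) / 2 + Real.sqrt (e + e) then true
  else if (hammingWt x : ℝ) < ((e + e : ℕ) : ℝ) / 2 - Real.sqrt (e + e) then false
  else xor (x (Fin.castAdd e i)) (x (Fin.natAdd e i))

theorem two_mul_hammingWt_sub {d : ℕ} (x : Fin d → Bool) :
    2 * (hammingWt x : ℝ) - d = ∑ i, if x i then (1 : ℝ) else -1 := by
  have h : ∀ i, (if x i then (1 : ℝ) else -1) = 2 * (if x i then 1 else 0) - 1 := by
    intro i; split <;> norm_num
  simp only [h, sum_sub_distrib, ← mul_sum, sum_boole, hammingWt]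
  simp

theorem sum_sq_signs (d : ℕ) :
    ∑ x : Fin d → Bool, (∑ i, if x i then (1 : ℝ) else -1) ^ 2 = d * 2 ^ d := by
  induction d with
  | zero => simp
  | succ n ih =>
    rw [← (Fin.consEquiv fun _ : Fin (n + 1) => Bool).sum_comp, Fintype.sum_prod_type]
    simp only [Fin.consEquiv_apply, Fin.sum_univ_succ, Fin.cons_zero, Fin.cons_succ,
      Fintype.sum_bool, if_true, Bool.false_eq_true, if_false]
    rw [← sum_add_distrib]
    have h : ∀ s : ℝ, (1 + s) ^ 2 + (-1 + s) ^ 2 = 2 + 2 * s ^ 2 := fun s => by ring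
    simp only [h, sum_add_distrib, ← mul_sum, ih]
    simp
    ring

/-- Chebyshev's inequality for the Hamming weight of a uniform point. -/
theorem card_hammingWt_far_le {d : ℕ} (t : ℝ) (ht : 0 ≤ t) :
    (2 * t) ^ 2 * ((univ.filter fun x : Fin d → Bool =>
      t < |(hammingWt x : ℝ) - d / 2|).card : ℝ) ≤ d * 2 ^ d := by
  rw [← sum_sq_signs, mul_comm, ← nsmul_eq_mul, ← sum_const]
  refine (sum_le_sum fun x hx => ?_).trans
    (sum_le_sum_of_subset_of_nonneg (filter_subset _ _) fun _ _ _ => sq_nonneg _)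
  rw [← two_mul_hammingWt_sub, sq_le_sq, abs_of_nonneg (by positivity),
    show 2 * (hammingWt x : ℝ) - d = 2 * (hammingWt x - d / 2) by ring, abs_mul,
    abs_of_pos (two_pos : (0 : ℝ) < 2)]
  have := (mem_filter.1 hx).2
  linarith

theorem hammingWt_update_le {d : ℕ} (x : Fin d → Bool) (a : Fin d) (p : Bool) :
    hammingWt (Function.update x a p) ≤ hammingWt x + 1 := by
  refine (card_le_card ?_).trans (card_insert_le a _)
  intro j hj
  by_cases h : j = a
  · simp [h]
  · simpa [h] using hj

theorem abs_hammingWt_update_sub_le {d : ℕ} (x : Fin d → Bool) (a : Fin d) (p : Bool) :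
    |(hammingWt (Function.update x a p) : ℝ) - hammingWt x| ≤ 1 := by
  have h₁ := hammingWt_update_le x a p
  have h₂ := hammingWt_update_le (Function.update x a p) a (x a)
  rw [Function.update_idem, Function.update_eq_self] at h₂
  rw [abs_sub_le_iff]
  constructor <;> rw [sub_le_iff_le_add'] <;> norm_cast

theorem fHard_eq_xor {e : ℕ} (i : Fin e) (x : Fin (e + e) → Bool)
    (hx : |(hammingWt x : ℝ) - ((e + e : ℕ) : ℝ) / 2| ≤ Real.sqrt (e + e)) :
    fHard i x = xor (x (Fin.castAdd e i)) (x (Fin.natAdd e i)) := by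
  rw [abs_sub_le_iff] at hx
  rw [fHard, if_neg (by linarith), if_neg (by linarith)]

/-- A unate function is not the XOR of two coordinates on any square in their directions. -/
theorem IsUnate.exists_ne_xor {d : ℕ} {g : (Fin d → Bool) → Bool} (hg : IsUnate g)
    (a b : Fin d) (x : Fin d → Bool) :
    ∃ p q, g (Function.update (Function.update x a p) b q) ≠ xor p q := by
  obtain ⟨σ, hσ⟩ := hg
  by_contra! h
  cases hb : σ b
  · exact absurd (by simpa [hb, h] using hσ b (Function.update x a false) : true ≤ false)
      (by decide)
  · exact absurd (by simpa [hb, h] using hσ b (Function.update x a true) : true ≤ false)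
      (by decide)

theorem exists_update_ne_fHard {e : ℕ} (i : Fin e) {g : (Fin (e + e) → Bool) → Bool}
    (hg : IsUnate g) (x : Fin (e + e) → Bool)
    (hx : |(hammingWt x : ℝ) - ((e + e : ℕ) : ℝ) / 2| ≤ Real.sqrt (e + e) - 2) :
    ∃ p q, g (Function.update (Function.update x (Fin.castAdd e i) p) (Fin.natAdd e i) q) ≠
      fHard i (Function.update (Function.update x (Fin.castAdd e i) p) (Fin.natAdd e i) q) := by
  obtain ⟨p, q, h⟩ := hg.exists_ne_xor (Fin.castAdd e i) (Fin.natAdd e i) x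
  refine ⟨p, q, ?_⟩
  have hab : Fin.castAdd e i ≠ Fin.natAdd e i := by
    simp only [ne_eq, Fin.ext_iff, Fin.val_castAdd, Fin.val_natAdd]
    have := i.isLt
    omega
  rw [fHard_eq_xor, Function.update_self, Function.update_of_ne hab, Function.update_self]
  · exact h
  · have h₁ := abs_hammingWt_update_sub_le x (Fin.castAdd e i) p
    have h₂ := abs_hammingWt_update_sub_le
      (Function.update x (Fin.castAdd e i) p) (Fin.natAdd e i) q
    rw [abs_le] at *
    constructor <;> linarith

theorem card_central_le {e : ℕ} (i : Fin e) {g : (Fin (e + e) → Bool) → Bool}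
    (hg : IsUnate g) :
    (univ.filter fun x : Fin (e + e) → Bool =>
      |(hammingWt x : ℝ) - ((e + e : ℕ) : ℝ) / 2| ≤ Real.sqrt (e + e) - 2).card ≤
      (univ.filter fun x : Fin (e + e) → Bool => g x ≠ fHard i x).card * 4 := by
  have key := fun x hx => exists_update_ne_fHard i hg x hx
  choose! p q h using key
  have h4 : 4 = (univ : Finset (Bool × Bool)).card := rfl
  rw [h4, ← card_product]
  refine card_le_card_of_injOn (fun x =>
    (Function.update (Function.update x (Fin.castAdd e i) (p x)) (Fin.natAdd e i) (q x),
      x (Fin.castAdd e i), x (Fin.natAdd e i))) ?_ ?_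
  · intro x hx
    simpa using h x (by simpa using hx)
  · intro x _ y _ hxy
    simp only [Prod.mk.injEq] at hxy
    obtain ⟨hu, ha, hb⟩ := hxy
    funext j
    have hj := congrFun hu j
    by_cases h₁ : j = Fin.castAdd e i
    · rw [h₁, ha]
    by_cases h₂ : j = Fin.natAdd e i
    · rw [h₂, hb]
    rwa [Function.update_of_ne h₂, Function.update_of_ne h₁, Function.update_of_ne h₂,
      Function.update_of_ne h₁] at hj

theorem half_le_card_central {d : ℕ} (hd : 64 ≤ d) :
    (2 : ℝ) ^ d / 2 ≤ ((univ.filter fun x : Fin d → Bool =>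
      |(hammingWt x : ℝ) - (d : ℝ) / 2| ≤ Real.sqrt d - 2).card : ℝ) := by
  have hs : (8 : ℝ) ≤ Real.sqrt d := Real.le_sqrt_of_sq_le (by norm_num; exact_mod_cast hd)
  have hsq : Real.sqrt d ^ 2 = d := Real.sq_sqrt (by positivity)
  have hfar := card_hammingWt_far_le (d := d) (Real.sqrt d - 2) (by linarith)
  have hsum := card_filter_add_card_filter_not (s := (univ : Finset (Fin d → Bool)))
    (fun x => |(hammingWt x : ℝ) - (d : ℝ) / 2| ≤ Real.sqrt d - 2)
  simp only [not_le, card_univ, Fintype.card_fun, Fintype.card_bool, Fintype.card_fin] at hsum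
  rify at hsum
  set B : ℝ := ((univ.filter fun x : Fin d → Bool =>
      Real.sqrt d - 2 < |(hammingWt x : ℝ) - d / 2|).card : ℝ)
  have hB : 0 ≤ B := Nat.cast_nonneg _
  have hd0 : (0 : ℝ) < d := by positivity
  have hcoef : 2 * (d : ℝ) ≤ (2 * (Real.sqrt d - 2)) ^ 2 := by nlinarith
  have : (d : ℝ) * (2 * B) ≤ d * 2 ^ d := by
    calc (d : ℝ) * (2 * B) = 2 * d * B := by ring
      _ ≤ _ := (mul_le_mul_of_nonneg_right hcoef hB).trans hfar
  have := le_of_mul_le_mul_left this hd0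
  linarith

theorem stmt_9 : ∃ ε : ℝ, 0 < ε ∧ ε ≤ 1 / 4 ∧ ∃ d₀ : ℕ,
    ∀ e : ℕ, d₀ ≤ e + e → ∀ i : Fin e,
      ∀ g : (Fin (e + e) → Bool) → Bool, IsUnate g →
        ε * 2 ^ (e + e) ≤
          ((univ.filter fun x : Fin (e + e) → Bool => g x ≠ fHard i x).card : ℝ) := by
  refine ⟨1 / 8, by norm_num, by norm_num, 64, fun e he i g hg => ?_⟩
  have h₁ := half_le_card_central he
  have h₂ := card_central_le i hg
  rw [← Nat.cast_add] at h₂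
  rify at h₂
  push_cast at h₁ h₂
  linarith
end

section
/- Let d be even, let i ∈ {1,…,d/2}, and let g : {0,1}^d → {0,1} be unate. Let x ∈ {0,1}^d and for a, b ∈ {0,1} let x^{ab} denote x with coordinate i set to a and coordinate i + d/2 set to b. If all four points x^{00}, x^{01}, x^{10}, x^{11} have Hamming weight in the interval [d/2 − √d, d/2 + √d], then g differs from f_i on at least one of these four points. -/
open Finset
open scoped Classical

/-- `x` with coordinate `i` set to `a` and coordinate `i + d/2` set to `b`. -/
def setPair {e : ℕ} (x : Fin (e + e) → Bool) (i : Fin e) (a b : Bool) :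
    Fin (e + e) → Bool :=
  Function.update (Function.update x (Fin.castAdd e i) a) (Fin.natAdd e i) b

theorem fHard_setPair {e : ℕ} {i : Fin e} {x : Fin (e + e) → Bool} {a b : Bool}
    (h : ((e + e : ℕ) : ℝ) / 2 - Real.sqrt (e + e) ≤ (hammingWt (setPair x i a b) : ℝ) ∧
      (hammingWt (setPair x i a b) : ℝ) ≤ ((e + e : ℕ) : ℝ) / 2 + Real.sqrt (e + e)) :
    fHard i (setPair x i a b) = xor a b := by
  have hne : Fin.castAdd e i ≠ Fin.natAdd e i := by
    have := i.isLt
    simp only [ne_eq, Fin.ext_iff, Fin.val_castAdd, Fin.val_natAdd]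
    omega
  rw [fHard, if_neg h.2.not_gt, if_neg h.1.not_gt]
  rw [setPair, Function.update_self, Function.update_of_ne hne, Function.update_self]

theorem stmt_10 (e : ℕ) (i : Fin e) (g : (Fin (e + e) → Bool) → Bool)
    (hg : IsUnate g) (x : Fin (e + e) → Bool)
    (hband : ∀ a b : Bool,
      ((e + e : ℕ) : ℝ) / 2 - Real.sqrt (e + e) ≤ (hammingWt (setPair x i a b) : ℝ) ∧
      (hammingWt (setPair x i a b) : ℝ) ≤ ((e + e : ℕ) : ℝ) / 2 + Real.sqrt (e + e)) :
    ∃ a b : Bool, g (setPair x i a b) ≠ fHard i (setPair x i a b) := by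
  by_contra! hfg
  have hxor (a b : Bool) : g (setPair x i a b) = xor a b :=
    (hfg a b).trans (fHard_setPair (hband a b))
  obtain ⟨σ, hσ⟩ := hg
  have hmono (a : Bool) : if σ (Fin.natAdd e i)
      then g (setPair x i a false) ≤ g (setPair x i a true)
      else g (setPair x i a true) ≤ g (setPair x i a false) :=
    hσ (Fin.natAdd e i) (Function.update x (Fin.castAdd e i) a)
  have hfalse := hmono false
  have htrue := hmono true
  simp only [hxor] at hfalse htrue
  split_ifs at hfalse htrue
  · exact absurd htrue (by decide)
  · exact absurd hfalse (by decide)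
end

section
/- Let d ≥ 1 and let Q be a nonempty finite set of points of {0,1}^d, each of whose points x has Hamming weight satisfying d/2 − √d ≤ |x| ≤ d/2 + √d. Then the number of coordinates i ∈ {1,…,d} for which there exist u, v ∈ Q with u ≤ v coordinatewise and u_i ≠ v_i is at most 2√d · (|Q| − 1). -/
open Finset
open scoped Classical

/-- Every finite graph has a spanning forest with fewer edges than there are vertices. -/
theorem SimpleGraph.exists_le_reachable_eq_card_edgeFinset_lt {V : Type*} [Fintype V] [Nonempty V]
    (G : SimpleGraph V) :
    ∃ F ≤ G, F.Reachable = G.Reachable ∧ #F.edgeFinset + 1 ≤ Fintype.card V := by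
  obtain ⟨F, hFG, hF, hreach⟩ := G.exists_isAcyclic_reachable_eq_le
  obtain ⟨T, hFT, -, hT⟩ :=
    SimpleGraph.connected_top.exists_isTree_le_of_le_of_isAcyclic (le_top : F ≤ ⊤) hF
  refine ⟨F, hFG, hreach, ?_⟩
  rw [← hT.card_edgeFinset]
  exact Nat.succ_le_succ (card_le_card (SimpleGraph.edgeFinset_mono hFT))

/-- A function constant along the edges of a graph is constant on its connected components. -/
theorem SimpleGraph.Reachable.apply_eq_of_forall_adj {V α : Type*} {G : SimpleGraph V} {f : V → α}
    (hf : ∀ a b, G.Adj a b → f a = f b) {u v : V} (h : G.Reachable u v) : f u = f v := by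
  obtain ⟨p⟩ := h
  induction p with
  | nil => rfl
  | cons hadj _ ih => exact (hf _ _ hadj).trans ih

/-- If the points attached to adjacent vertices differ in at most `c` coordinates, then the number
of coordinates in which some two adjacent vertices differ is at most `c` times one less than the
number of vertices. -/
theorem SimpleGraph.card_filter_exists_adj_ne_le {V ι α : Type*} [Fintype V] [Nonempty V]
    [Fintype ι] [DecidableEq α] (G : SimpleGraph V) (f : V → ι → α) {c : ℝ} (hc : 0 ≤ c)
    (h : ∀ a b, G.Adj a b → (#{i | f a i ≠ f b i} : ℝ) ≤ c) :
    (#{i | ∃ a b, G.Adj a b ∧ f a i ≠ f b i} : ℝ) ≤ c * ((Fintype.card V : ℝ) - 1) := by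
  obtain ⟨F, hFG, hreach, hcard⟩ := G.exists_le_reachable_eq_card_edgeFinset_lt
  let D : Sym2 V → Finset ι := fun e => {i | ∃ a b, e = s(a, b) ∧ f a i ≠ f b i}
  have hsub : ({i | ∃ a b, G.Adj a b ∧ f a i ≠ f b i} : Finset ι) ⊆ F.edgeFinset.biUnion D := by
    intro i hi
    obtain ⟨a, b, hab, hne⟩ := (mem_filter.mp hi).2
    have hr : F.Reachable a b := hreach ▸ hab.reachable
    by_contra hi'
    refine hne (hr.apply_eq_of_forall_adj (f := fun v => f v i) fun x y hxy => ?_)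
    by_contra hxyi
    exact hi' (mem_biUnion.mpr ⟨s(x, y), by simpa using hxy, by
      simpa only [D, mem_filter, mem_univ, true_and] using ⟨x, y, rfl, hxyi⟩⟩)
  have hD : ∀ e ∈ F.edgeFinset, (#(D e) : ℝ) ≤ c := by
    intro e
    induction e with
    | _ a b =>
      intro he
      refine le_trans ?_ (h a b (hFG (by simpa using he)))
      gcongr
      intro i hi
      obtain ⟨x, y, hxy, hne⟩ := (mem_filter.mp hi).2
      simp only [mem_filter, mem_univ, true_and]
      rcases Sym2.eq_iff.mp hxy with ⟨rfl, rfl⟩ | ⟨rfl, rfl⟩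
      · exact hne
      · exact hne.symm
  calc (#{i | ∃ a b, G.Adj a b ∧ f a i ≠ f b i} : ℝ)
      ≤ ∑ e ∈ F.edgeFinset, (#(D e) : ℝ) := by
        exact_mod_cast (card_le_card hsub).trans card_biUnion_le
    _ ≤ #F.edgeFinset • c := sum_le_card_nsmul _ _ _ hD
    _ = c * #F.edgeFinset := by rw [nsmul_eq_mul, mul_comm]
    _ ≤ c * ((Fintype.card V : ℝ) - 1) := by
        gcongr
        rw [le_sub_iff_add_le]
        exact_mod_cast hcard

theorem card_filter_ne_add_hammingWt {d : ℕ} {u v : Fin d → Bool} (h : u ≤ v) :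
    #{i | u i ≠ v i} + hammingWt u = hammingWt v := by
  unfold hammingWt
  rw [← card_union_of_disjoint]
  · congr 1
    ext i
    have hi := Bool.le_iff_imp.mp (h i)
    cases hu : u i <;> cases hv : v i <;> simp_all
  · rw [disjoint_filter]
    intro i _ hne hu
    have hv := Bool.le_iff_imp.mp (h i) hu
    exact hne (hu.trans hv.symm)

theorem stmt_11 (d : ℕ) (hd : 1 ≤ d) (Q : Finset (Fin d → Bool)) (hQ : Q.Nonempty)
    (hband : ∀ x ∈ Q,
      (d : ℝ) / 2 - Real.sqrt d ≤ (hammingWt x : ℝ) ∧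
      (hammingWt x : ℝ) ≤ (d : ℝ) / 2 + Real.sqrt d) :
    ((univ.filter fun i : Fin d =>
        ∃ u ∈ Q, ∃ v ∈ Q, (∀ j, u j ≤ v j) ∧ u i ≠ v i).card : ℝ) ≤
      2 * Real.sqrt d * ((Q.card : ℝ) - 1) := by
  have : Nonempty Q := hQ.to_subtype
  let G : SimpleGraph Q := SimpleGraph.fromRel fun u v => u.1 ≤ v.1
  have hle : ∀ u v : Q, u.1 ≤ v.1 → (#{i | u.1 i ≠ v.1 i} : ℝ) ≤ 2 * Real.sqrt d := by
    intro u v huv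
    have hwt : (#{i | u.1 i ≠ v.1 i} : ℝ) + hammingWt u.1 = hammingWt v.1 := by
      exact_mod_cast card_filter_ne_add_hammingWt huv
    linarith [(hband u.1 u.2).1, (hband v.1 v.2).2]
  have hG : ∀ a b : Q, G.Adj a b → (#{i | a.1 i ≠ b.1 i} : ℝ) ≤ 2 * Real.sqrt d := by
    intro a b hab
    rcases ((SimpleGraph.fromRel_adj _ _ _).mp hab).2 with h | h
    · exact hle a b h
    · simpa only [ne_comm] using hle b a h
  have hmain := G.card_filter_exists_adj_ne_le (fun q : Q => q.1) (c := 2 * Real.sqrt d)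
    (by positivity) hG
  rw [Fintype.card_coe] at hmain
  refine le_trans ?_ hmain
  gcongr with i
  rintro ⟨u, hu, v, hv, huv, hne⟩
  exact ⟨⟨u, hu⟩, ⟨v, hv⟩, (SimpleGraph.fromRel_adj _ _ _).mpr
    ⟨fun h => hne (congrFun (congrArg Subtype.val h) i), Or.inl huv⟩, hne⟩
end

section
/- Fix integers n ≥ 1 and d ≥ 1, a function f : [n]^d → ℝ, a set T ⊆ {1,…,d}, and a coordinate i ∉ T. Then Φ_f(T ∪ {i}) ≤ Φ_f(T). -/
open Finset
open scoped Classical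

/-- The point of `[n]^d` agreeing with `z` on the coordinates in `T` and with
`w` on the coordinates outside `T`. -/
def combine {n d : ℕ} (T : Finset (Fin d))
    (z : {i : Fin d // i ∈ T} → Fin n) (w : {i : Fin d // i ∉ T} → Fin n) :
    Fin d → Fin n :=
  fun i => if h : i ∈ T then z ⟨i, h⟩ else w ⟨i, h⟩

/-- `P_v^z`: the fraction of assignments `w` to the coordinates outside `T`
for which `f(z ∘_T w) = v`. -/
noncomputable def Pfrac {n d : ℕ} (f : (Fin d → Fin n) → ℝ) (T : Finset (Fin d))
    (z : {i : Fin d // i ∈ T} → Fin n) (v : ℝ) : ℝ :=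
  ((univ.filter fun w : {i : Fin d // i ∉ T} → Fin n =>
      f (combine T z w) = v).card : ℝ) / (n : ℝ) ^ (d - T.card)

/-- `Φ_f(T) = n^{-|T|} Σ_z Σ_{v ∈ image f} P_v^z (1 - P_v^z)`. -/
noncomputable def Phi {n d : ℕ} (f : (Fin d → Fin n) → ℝ) (T : Finset (Fin d)) : ℝ :=
  (∑ z : {i : Fin d // i ∈ T} → Fin n, ∑ v ∈ univ.image f,
      Pfrac f T z v * (1 - Pfrac f T z v)) / (n : ℝ) ^ T.card

/-- An assignment on `insert i T` is a value at `i` together with an assignment on `T`. -/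
def insertMemEquiv {α ι : Type*} [DecidableEq ι] {T : Finset ι} {i : ι} (hi : i ∉ T) :
    ({j : ι // j ∈ insert i T} → α) ≃ α × ({j : ι // j ∈ T} → α) where
  toFun z := (z ⟨i, mem_insert_self i T⟩, fun j => z ⟨j, mem_insert_of_mem j.2⟩)
  invFun p j := if h : j.1 ∈ T then p.2 ⟨j, h⟩ else p.1
  left_inv z := by
    funext ⟨j, hj⟩
    by_cases h : j ∈ T
    · simp [h]
    · obtain rfl : j = i := (mem_insert.1 hj).resolve_right h
      simp [h]
  right_inv p := by
    ext j <;> simp [hi]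

/-- An assignment off `T` is a value at `i ∉ T` together with an assignment off `insert i T`. -/
def notMemInsertEquiv {α ι : Type*} [DecidableEq ι] {T : Finset ι} {i : ι} (hi : i ∉ T) :
    ({j : ι // j ∉ T} → α) ≃ α × ({j : ι // j ∉ insert i T} → α) where
  toFun w := (w ⟨i, hi⟩, fun j => w ⟨j, fun h => j.2 (mem_insert_of_mem h)⟩)
  invFun p j := if h : j.1 = i then p.1 else
    p.2 ⟨j, fun hj => (mem_insert.1 hj).elim h j.2⟩
  left_inv w := by
    funext ⟨j, hj⟩
    by_cases h : j = i
    · subst h; simp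
    · simp [h]
  right_inv p := by
    refine Prod.ext (by simp) (funext fun j => ?_)
    have h : j.1 ≠ i := fun h => j.2 (mem_insert.2 (Or.inl h))
    simp [h]

theorem combine_insert {n d : ℕ} {T : Finset (Fin d)} {i : Fin d} (hi : i ∉ T)
    (z : {j : Fin d // j ∈ T} → Fin n) (a : Fin n)
    (w : {j : Fin d // j ∉ insert i T} → Fin n) :
    combine T z ((notMemInsertEquiv hi).symm (a, w)) =
      combine (insert i T) ((insertMemEquiv hi).symm (a, z)) w := by
  funext j
  by_cases hj : j ∈ T
  · simp [combine, insertMemEquiv, hj]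
  · by_cases h : j = i
    · subst h; simp [combine, insertMemEquiv, notMemInsertEquiv, hj]
    · simp [combine, notMemInsertEquiv, hj, h]

/-- Averaging over the value at `i ∉ T`. -/
theorem Pfrac_eq_sum_insert {n d : ℕ} (f : (Fin d → Fin n) → ℝ) {T : Finset (Fin d)}
    {i : Fin d} (hi : i ∉ T) (z : {j : Fin d // j ∈ T} → Fin n) (v : ℝ) :
    Pfrac f T z v =
      (∑ a, Pfrac f (insert i T) ((insertMemEquiv hi).symm (a, z)) v) / n := by
  have hT : T.card + 1 ≤ d := by
    simpa [card_insert_of_notMem hi] using card_le_univ (insert i T)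
  have hd : d - T.card = d - (insert i T).card + 1 := by
    rw [card_insert_of_notMem hi]; omega
  simp only [Pfrac]
  rw [← sum_div, div_div, hd, ← pow_succ]
  congr 1
  simp only [natCast_card_filter]
  rw [← (notMemInsertEquiv hi).symm.sum_comp, Fintype.sum_prod_type]
  simp only [combine_insert]

/-- Concavity of `x ↦ x (1 - x)`. -/
theorem sum_mul_one_sub_div_le {ι : Type*} [Fintype ι] [Nonempty ι] (x : ι → ℝ) :
    (∑ a, x a * (1 - x a)) / Fintype.card ι ≤
      (∑ a, x a) / Fintype.card ι * (1 - (∑ a, x a) / Fintype.card ι) := by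
  have hc : (0 : ℝ) < Fintype.card ι := by exact_mod_cast Fintype.card_pos
  have h : (∑ a, x a) ^ 2 ≤ Fintype.card ι * ∑ a, x a ^ 2 := sq_sum_le_card_mul_sum_sq
  have e : ∑ a, x a * (1 - x a) = ∑ a, x a - ∑ a, x a ^ 2 := by
    rw [← sum_sub_distrib]; exact sum_congr rfl fun a _ => by ring
  have h' : ((∑ a, x a) / Fintype.card ι) ^ 2 ≤ (∑ a, x a ^ 2) / Fintype.card ι := by
    rw [div_pow, div_le_div_iff₀ (by positivity) hc]
    nlinarith
  rw [e, sub_div]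
  linarith

theorem stmt_14 (n d : ℕ) (hn : 1 ≤ n) (hd : 1 ≤ d) (f : (Fin d → Fin n) → ℝ)
    (T : Finset (Fin d)) (i : Fin d) (hi : i ∉ T) :
    Phi f (insert i T) ≤ Phi f T := by
  have : NeZero n := ⟨by omega⟩
  rw [Phi, Phi, card_insert_of_notMem hi, pow_succ', ← div_div]
  gcongr
  rw [← (insertMemEquiv hi).symm.sum_comp, Fintype.sum_prod_type_right, sum_div]
  refine sum_le_sum fun z _ => ?_
  rw [sum_comm, sum_div]
  refine sum_le_sum fun v _ => ?_
  rw [Pfrac_eq_sum_insert f hi]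
  simpa using sum_mul_one_sub_div_le
    fun a => Pfrac f (insert i T) ((insertMemEquiv hi).symm (a, z)) v
end

section
/- Fix integers n ≥ 1 and d ≥ 1, a function f : [n]^d → ℝ, a set T ⊆ {1,…,d}, and a plurality function Pl_T (for each z : T → [n], Pl_T(z) is a value v in the image of f maximizing P_v^z). Then |{x ∈ [n]^d : f(x) ≠ Pl_T(x|_T)}| ≤ Φ_f(T) · n^d, where x|_T denotes the restriction of x to the coordinates in T. -/
open Finset
open scoped Classical

theorem card_complement_assignments {n d : ℕ} (T : Finset (Fin d)) :
    Fintype.card ({i : Fin d // i ∉ T} → Fin n) = n ^ (d - T.card) := by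
  rw [Fintype.card_fun, Fintype.card_fin, Fintype.card_subtype_compl, Fintype.card_fin,
    Fintype.card_coe]

theorem Pfrac_mul_pow {n d : ℕ} (hn : 1 ≤ n) (f : (Fin d → Fin n) → ℝ) (T : Finset (Fin d))
    (z : {i : Fin d // i ∈ T} → Fin n) (v : ℝ) :
    Pfrac f T z v * (n : ℝ) ^ (d - T.card) =
      ((univ.filter fun w : {i : Fin d // i ∉ T} → Fin n => f (combine T z w) = v).card : ℝ) :=
  div_mul_cancel₀ _ (pow_ne_zero _ (by positivity))

theorem sum_Pfrac {n d : ℕ} (hn : 1 ≤ n) (f : (Fin d → Fin n) → ℝ) (T : Finset (Fin d))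
    (z : {i : Fin d // i ∈ T} → Fin n) :
    ∑ v ∈ univ.image f, Pfrac f T z v = 1 := by
  have hpos : (0 : ℝ) < (n : ℝ) ^ (d - T.card) := by positivity
  refine mul_right_cancel₀ hpos.ne' ?_
  simp only [sum_mul, Pfrac_mul_pow hn, one_mul]
  have h := card_eq_sum_card_fiberwise
    (s := (univ : Finset ({i : Fin d // i ∉ T} → Fin n))) (t := univ.image f)
    (f := fun w => f (combine T z w)) (fun w _ => by simp)
  rw [card_univ, card_complement_assignments] at h
  exact_mod_cast h.symm

theorem one_sub_Pfrac_le {n d : ℕ} (hn : 1 ≤ n) (f : (Fin d → Fin n) → ℝ)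
    (T : Finset (Fin d)) (z : {i : Fin d // i ∈ T} → Fin n) (u : ℝ)
    (hu : ∀ v ∈ univ.image f, Pfrac f T z v ≤ Pfrac f T z u) :
    1 - Pfrac f T z u ≤ ∑ v ∈ univ.image f, Pfrac f T z v * (1 - Pfrac f T z v) := by
  have h : ∑ v ∈ univ.image f, Pfrac f T z v * (1 - Pfrac f T z u) ≤
      ∑ v ∈ univ.image f, Pfrac f T z v * (1 - Pfrac f T z v) := by
    refine sum_le_sum fun v hv => mul_le_mul_of_nonneg_left (by linarith [hu v hv]) ?_
    unfold Pfrac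
    positivity
  rwa [← sum_mul, sum_Pfrac hn, one_mul] at h

theorem card_filter_ne_eq {n d : ℕ} (hn : 1 ≤ n) (f : (Fin d → Fin n) → ℝ)
    (T : Finset (Fin d)) (z : {i : Fin d // i ∈ T} → Fin n) (u : ℝ) :
    ((univ.filter fun w : {i : Fin d // i ∉ T} → Fin n => f (combine T z w) ≠ u).card : ℝ) =
      (1 - Pfrac f T z u) * (n : ℝ) ^ (d - T.card) := by
  have h := card_filter_add_card_filter_not
    (s := (univ : Finset ({i : Fin d // i ∉ T} → Fin n))) (fun w => f (combine T z w) = u)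
  rw [card_univ, card_complement_assignments] at h
  rw [sub_mul, one_mul, Pfrac_mul_pow hn, eq_sub_iff_add_eq']
  exact_mod_cast h

theorem card_filter_ne_eq_sum {n d : ℕ} (f : (Fin d → Fin n) → ℝ) (T : Finset (Fin d))
    (g : ({i : Fin d // i ∈ T} → Fin n) → ℝ) :
    (univ.filter fun x : Fin d → Fin n => f x ≠ g (fun i => x i.1)).card =
      ∑ z : {i : Fin d // i ∈ T} → Fin n,
        (univ.filter fun w : {i : Fin d // i ∉ T} → Fin n => f (combine T z w) ≠ g z).card := by
  simp only [card_filter]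
  rw [← Fintype.sum_prod_type'
    (f := fun (z : {i : Fin d // i ∈ T} → Fin n) (w : {i : Fin d // i ∉ T} → Fin n) =>
      if f (combine T z w) ≠ g z then 1 else 0)]
  refine Fintype.sum_equiv (Equiv.piEquivPiSubtypeProd (fun i => i ∈ T) fun _ => Fin n) _ _
    fun x => ?_
  have hx : combine T (fun i => x i.1) (fun i => x i.1) = x := by
    funext i
    simp [combine]
  simp [Equiv.piEquivPiSubtypeProd, hx]

theorem stmt_17 (n d : ℕ) (hn : 1 ≤ n) (hd : 1 ≤ d) (f : (Fin d → Fin n) → ℝ)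
    (T : Finset (Fin d)) (Pl : ({i : Fin d // i ∈ T} → Fin n) → ℝ)
    (hPl : ∀ z : {i : Fin d // i ∈ T} → Fin n,
      Pl z ∈ univ.image f ∧ ∀ v ∈ univ.image f, Pfrac f T z v ≤ Pfrac f T z (Pl z)) :
    ((univ.filter fun x : Fin d → Fin n =>
        f x ≠ Pl (fun i => x i.1)).card : ℝ) ≤ Phi f T * (n : ℝ) ^ d := by
  have hn0 : (n : ℝ) ≠ 0 := by positivity
  have hT : T.card ≤ d := by simpa using card_le_univ T
  rw [card_filter_ne_eq_sum, Nat.cast_sum]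
  simp only [card_filter_ne_eq hn]
  have hpow : (n : ℝ) ^ d = (n : ℝ) ^ T.card * (n : ℝ) ^ (d - T.card) :=
    (pow_mul_pow_sub _ hT).symm
  rw [← sum_mul, Phi, hpow, ← mul_assoc, div_mul_cancel₀ _ (pow_ne_zero _ hn0)]
  gcongr with z
  exact one_sub_Pfrac_le hn f T z (Pl z) (hPl z).2
end
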